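/- For every integer k ≥ 0, the real vector space G_k^⊕ := {x ↦ x ∧ q(x) : q ∈ (P_{k-1}(ℝ³))³} has dimension (k+2)(k+3)(2k−1)/6 + 1; equivalently, dim G_k^⊕ = 3·dim P_k(ℝ³) − (dim P_{k+1}(ℝ³) − 1), where dim P_m(ℝ³) = (m+1)(m+2)(m+3)/6. -/

import Mathlib

open Matrix

/-- The subspace of polynomial functions `ℝ³ → ℝ` of total degree at most `k`
(with the convention `P_{-1} = {0}` for `k < 0`). -/
def polyDeg (k : ℤ) : Submodule ℝ ((Fin 3 → ℝ) → ℝ) where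
  carrier := {f | ∃ P : MvPolynomial (Fin 3) ℝ,
    (∀ m ∈ P.support, ((m.sum fun _ e => e : ℕ) : ℤ) ≤ k) ∧
    ∀ x, f x = MvPolynomial.eval x P}
  zero_mem' := ⟨0, by simp, by simp⟩
  add_mem' := by
    rintro f g ⟨P, hP, hfP⟩ ⟨Q, hQ, hgQ⟩
    refine ⟨P + Q, fun m hm => ?_, fun x => by simp [hfP, hgQ]⟩
    rcases Finset.mem_union.mp (MvPolynomial.support_add hm) with h | h
    exacts [hP m h, hQ m h]
  smul_mem' := by
    rintro c f ⟨P, hP, hfP⟩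
    exact ⟨c • P, fun m hm => hP m (MvPolynomial.support_smul hm),
      fun x => by simp [hfP]⟩

/-- The subspace of vector fields `ℝ³ → ℝ³` whose three components lie in `polyDeg k`. -/
def polyVec (k : ℤ) : Submodule ℝ ((Fin 3 → ℝ) → (Fin 3 → ℝ)) where
  carrier := {v | ∀ i : Fin 3, (fun x => v x i) ∈ polyDeg k}
  zero_mem' := fun i => (polyDeg k).zero_mem
  add_mem' := fun hf hg i => (polyDeg k).add_mem (hf i) (hg i)
  smul_mem' := fun c _ hf i => (polyDeg k).smul_mem c (hf i)

/-- The linear map `q ↦ (x ↦ x ∧ q(x))` on vector fields. -/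
def crossMap : ((Fin 3 → ℝ) → (Fin 3 → ℝ)) →ₗ[ℝ] ((Fin 3 → ℝ) → (Fin 3 → ℝ)) where
  toFun q := fun x => crossProduct x (q x)
  map_add' q r := funext fun x => by simp
  map_smul' c q := funext fun x => by simp

/-- The space `G_k^⊕ = x ∧ (P_{k-1})³`, as a subspace of vector fields on `ℝ³`. -/
def GspaceOplus (k : ℤ) : Submodule ℝ ((Fin 3 → ℝ) → (Fin 3 → ℝ)) :=
  (polyVec (k - 1)).map crossMap

open MvPolynomial in
/-- Evaluation of real polynomials in three variables as functions, as a linear map. -/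
noncomputable def evalLin : MvPolynomial (Fin 3) ℝ →ₗ[ℝ] ((Fin 3 → ℝ) → ℝ) :=
  LinearMap.pi fun x => (aeval x).toLinearMap

theorem evalLin_apply (P : MvPolynomial (Fin 3) ℝ) (x : Fin 3 → ℝ) :
    evalLin P x = MvPolynomial.eval x P := by
  simp [evalLin, MvPolynomial.aeval_eq_eval]

theorem evalLin_injective : Function.Injective evalLin := fun P Q h =>
  MvPolynomial.funext fun x => by
    rw [← evalLin_apply, ← evalLin_apply, h]

/-- The exponents of total degree at most `k`. -/
def degLE (k : ℤ) : Set (Fin 3 →₀ ℕ) := {m | ((m.sum fun _ e => e : ℕ) : ℤ) ≤ k}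

theorem polyDeg_eq_map (k : ℤ) :
    polyDeg k = (MvPolynomial.restrictSupport ℝ (degLE k)).map evalLin := by
  ext f
  constructor
  · rintro ⟨P, hP, hf⟩
    exact ⟨P, (MvPolynomial.mem_restrictSupport_iff ℝ).2 hP,
      funext fun x => by rw [hf, evalLin_apply]⟩
  · rintro ⟨P, hP, rfl⟩
    exact ⟨P, (MvPolynomial.mem_restrictSupport_iff ℝ).1 hP, evalLin_apply P⟩

theorem degLE_natCast (n : ℕ) : degLE n =
    ((Finset.range (n + 1)).biUnion fun d => Finset.finsuppAntidiag Finset.univ d :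
      Finset (Fin 3 →₀ ℕ)) := by
  ext m
  simp only [degLE, Set.mem_ofPred_eq, Nat.cast_le, Finset.mem_coe,
    Finset.mem_biUnion, Finset.mem_range, Finset.mem_finsuppAntidiag, Finset.subset_univ,
    and_true, exists_eq_right', Nat.lt_succ_iff]
  rw [Finsupp.sum_fintype _ _ fun _ => rfl]

theorem degLE_of_neg {k : ℤ} (hk : k < 0) : degLE k = ∅ :=
  Set.eq_empty_of_forall_notMem fun m (hm : _ ≤ k) => by lia

theorem finite_degLE (k : ℤ) : (degLE k).Finite := by
  rcases lt_or_ge k 0 with hk | hk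
  · simp [degLE_of_neg hk]
  · lift k to ℕ using hk
    rw [degLE_natCast]
    exact Finset.finite_toSet _

theorem six_mul_ncard_degLE (n : ℕ) :
    6 * (degLE n).ncard = (n + 1) * (n + 2) * (n + 3) := by
  rw [degLE_natCast, Set.ncard_coe_finset, Finset.card_biUnion]
  · induction n with
    | zero => simp
    | succ n ih =>
      rw [Finset.sum_range_succ, mul_add, ih, Finset.card_finsuppAntidiag_nat_eq_choose]
      have h : (n + 3).choose 2 * 2 = (n + 3) * (n + 2) := by
        rw [Nat.choose_two_right]
        exact Nat.div_mul_cancel (Nat.even_mul_pred_self (n + 3)).two_dvd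
      have h' : (Finset.univ.card (α := Fin 3) + (n + 1) - 1).choose (n + 1)
          = (n + 3).choose 2 := by
        simp only [Finset.card_univ, Fintype.card_fin]
        exact Nat.choose_symm_of_eq_add (n := 3 + (n + 1) - 1) (a := n + 1) (b := 2) (by lia) |>.trans
          (by congr 1; lia)
      rw [h']
      linarith
  · intro a _ b _ hab
    refine Finset.disjoint_left.2 fun m ha hb => hab ?_
    rw [Finset.mem_finsuppAntidiag] at ha hb
    exact ha.1.symm.trans hb.1

theorem finrank_polyDeg (k : ℤ) : Module.finrank ℝ (polyDeg k) = (degLE k).ncard := by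
  rw [polyDeg_eq_map, ← (Submodule.equivMapOfInjective _ evalLin_injective _).finrank_eq,
    Module.finrank_eq_nat_card_basis (MvPolynomial.basisRestrictSupport ℝ (degLE k)),
    Nat.card_coe_set_eq]

theorem six_mul_finrank_polyDeg {k : ℤ} (hk : -3 ≤ k) :
    6 * (Module.finrank ℝ (polyDeg k) : ℤ) = (k + 1) * (k + 2) * (k + 3) := by
  rw [finrank_polyDeg]
  rcases lt_or_ge k 0 with h | h
  · rw [degLE_of_neg h]
    interval_cases k <;> simp
  · lift k to ℕ using h
    exact_mod_cast six_mul_ncard_degLE k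

instance finiteDimensional_polyDeg (k : ℤ) : FiniteDimensional ℝ (polyDeg k) := by
  have : Finite (degLE k) := finite_degLE k
  have := Module.Finite.of_basis (MvPolynomial.basisRestrictSupport ℝ (degLE k))
  rw [polyDeg_eq_map]
  infer_instance

/-- A vector field with components in `polyDeg k` is a triple of elements of `polyDeg k`. -/
def polyVecEquiv (k : ℤ) : polyVec k ≃ₗ[ℝ] (Fin 3 → polyDeg k) where
  toFun v i := ⟨fun x => v.1 x i, v.2 i⟩
  invFun f := ⟨fun x i => (f i).1 x, fun i => (f i).2⟩
  map_add' _ _ := rfl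
  map_smul' _ _ := rfl
  left_inv _ := rfl
  right_inv _ := rfl

theorem finrank_polyVec (k : ℤ) :
    Module.finrank ℝ (polyVec k) = 3 * Module.finrank ℝ (polyDeg k) := by
  simp [(polyVecEquiv k).finrank_eq, Module.finrank_pi_fintype]

instance finiteDimensional_polyVec (k : ℤ) : FiniteDimensional ℝ (polyVec k) :=
  (polyVecEquiv k).symm.finiteDimensional

/-- The linear map `p ↦ (x ↦ p(x) x)`. -/
def radialMap : ((Fin 3 → ℝ) → ℝ) →ₗ[ℝ] ((Fin 3 → ℝ) → (Fin 3 → ℝ)) where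
  toFun p := fun x => p x • x
  map_add' p r := funext fun x => by simp [add_smul]
  map_smul' c p := funext fun x => by simp [mul_smul]

open MvPolynomial in
theorem X_mul_mem_restrictSupport_degLE_iff {k : ℤ} {i : Fin 3} {P : MvPolynomial (Fin 3) ℝ} :
    X i * P ∈ restrictSupport ℝ (degLE (k + 1)) ↔ P ∈ restrictSupport ℝ (degLE k) := by
  have h (m : Fin 3 →₀ ℕ) : Finsupp.single i 1 + m ∈ degLE (k + 1) ↔ m ∈ degLE k := by
    simp only [degLE, Set.mem_ofPred_eq]
    rw [Finsupp.sum_add_index' (by simp) (by simp), Finsupp.sum_single_index rfl]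
    lia
  simp only [mem_restrictSupport_iff, Set.subset_def, Finset.mem_coe, support_X_mul,
    Finset.mem_map, addLeftEmbedding_apply]
  constructor
  · exact fun H m hm => (h m).1 (H _ ⟨m, hm, rfl⟩)
  · rintro H _ ⟨m, hm, rfl⟩
    exact (h m).2 (H m hm)

open MvPolynomial in
/-- A triple of polynomials parallel to `(X 0, X 1, X 2)` is a multiple of it. -/
theorem exists_eq_X_mul {P : Fin 3 → MvPolynomial (Fin 3) ℝ}
    (h : ∀ i j, X i * P j = X j * P i) : ∃ Q, ∀ i, P i = X i * Q := by
  have hdvd : (X 0 : MvPolynomial (Fin 3) ℝ) ∣ X 1 * P 0 := ⟨P 1, h 1 0⟩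
  obtain ⟨Q, hQ⟩ := (X_prime.dvd_or_dvd hdvd).resolve_left (by simp [X_dvd_X])
  refine ⟨Q, fun i => mul_left_cancel₀ (X_ne_zero (R := ℝ) (0 : Fin 3)) ?_⟩
  rw [h, hQ]
  ring

theorem crossMap_eq_zero_iff {q : (Fin 3 → ℝ) → (Fin 3 → ℝ)} :
    crossMap q = 0 ↔ ∀ x i j, x i * q x j = x j * q x i := by
  rw [funext_iff]
  refine forall_congr' fun x => ?_
  simp only [crossMap, LinearMap.coe_mk, AddHom.coe_mk, Pi.zero_apply, cross_apply,
    funext_iff, Fin.forall_fin_succ]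
  simp
  grind

theorem map_radialMap_polyDeg (k : ℤ) :
    (polyDeg k).map radialMap = polyVec (k + 1) ⊓ LinearMap.ker crossMap := by
  ext q
  simp only [Submodule.mem_inf, LinearMap.mem_ker, crossMap_eq_zero_iff]
  constructor
  · rintro ⟨f, hf, rfl⟩
    rw [SetLike.mem_coe, polyDeg_eq_map] at hf
    obtain ⟨P, hP, rfl⟩ := hf
    refine ⟨fun i => ?_, fun x i j => ?_⟩
    · rw [polyDeg_eq_map]
      refine ⟨MvPolynomial.X i * P, X_mul_mem_restrictSupport_degLE_iff.2 hP, funext fun x => ?_⟩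
      simp [radialMap, evalLin_apply, mul_comm]
    · simp only [radialMap, LinearMap.coe_mk, AddHom.coe_mk, Pi.smul_apply, smul_eq_mul]
      ring
  · rintro ⟨hq, h⟩
    have hq' (i : Fin 3) := polyDeg_eq_map (k + 1) ▸ hq i
    choose P hP hPq using hq'
    have hval (x : Fin 3 → ℝ) (i : Fin 3) : q x i = MvPolynomial.eval x (P i) := by
      rw [← evalLin_apply, hPq]
    obtain ⟨Q, hQ⟩ := exists_eq_X_mul (P := P) fun i j => MvPolynomial.funext fun x => by
      simpa [hval] using h x i j
    refine ⟨evalLin Q, ?_, funext fun x => funext fun i => ?_⟩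
    · rw [polyDeg_eq_map]
      exact ⟨Q, X_mul_mem_restrictSupport_degLE_iff.1 (hQ 0 ▸ hP 0), rfl⟩
    · simp [radialMap, hval, hQ, evalLin_apply, mul_comm]

theorem finrank_map_radialMap_polyDeg (k : ℤ) :
    Module.finrank ℝ ((polyDeg k).map radialMap) = Module.finrank ℝ (polyDeg k) := by
  have hinj : Function.Injective (radialMap.domRestrict (polyDeg k)) := by
    rw [← LinearMap.ker_eq_bot, LinearMap.ker_eq_bot']
    rintro ⟨f, hf⟩ h
    rw [polyDeg_eq_map] at hf
    obtain ⟨P, -, rfl⟩ := hf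
    have hP : MvPolynomial.X 0 * P = 0 := MvPolynomial.funext fun x => by
      simpa [radialMap, evalLin_apply, or_comm] using congrFun (congrFun h x) 0
    simp [(mul_eq_zero.1 hP).resolve_left (MvPolynomial.X_ne_zero 0)]
  rw [← LinearMap.finrank_range_of_inj hinj, LinearMap.range_domRestrict]

theorem finrank_GspaceOplus_add (k : ℤ) :
    Module.finrank ℝ (GspaceOplus k) + Module.finrank ℝ (polyDeg (k - 2))
      = 3 * Module.finrank ℝ (polyDeg (k - 1)) := by
  have h := (crossMap.domRestrict (polyVec (k - 1))).finrank_range_add_finrank_ker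
  rw [LinearMap.range_domRestrict, finrank_polyVec] at h
  rw [← h, GspaceOplus, ← finrank_map_radialMap_polyDeg, map_radialMap_polyDeg,
    show k - 2 + 1 = k - 1 by ring, LinearMap.ker_domRestrict, ← Submodule.map_comap_subtype,
    ← (Submodule.equivMapOfInjective _ (Submodule.injective_subtype _) _).finrank_eq]

/-- `dim G_k^⊕ = (k+2)(k+3)(2k−1)/6 + 1 = 3 dim P_k − (dim P_{k+1} − 1)`, where
`dim P_m = (m+1)(m+2)(m+3)/6`. -/
theorem statement8 (k : ℕ) :
    (Module.finrank ℝ (GspaceOplus k) : ℤ)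
        = ((k : ℤ) + 2) * ((k : ℤ) + 3) * (2 * (k : ℤ) - 1) / 6 + 1 ∧
    (Module.finrank ℝ (GspaceOplus k) : ℤ)
        = 3 * (Module.finrank ℝ (polyDeg (k : ℤ)) : ℤ)
          - ((Module.finrank ℝ (polyDeg ((k : ℤ) + 1)) : ℤ) - 1) ∧
    ∀ m : ℕ, (Module.finrank ℝ (polyDeg (m : ℤ)) : ℤ)
        = ((m : ℤ) + 1) * ((m : ℤ) + 2) * ((m : ℤ) + 3) / 6 := by
  have hdim (j : ℤ) (hj : -3 ≤ j) := six_mul_finrank_polyDeg hj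
  have hG := finrank_GspaceOplus_add k
  have h₀ := hdim k (by lia)
  have h₁ := hdim (k + 1) (by lia)
  have h₂ := hdim (k - 1) (by lia)
  have h₃ := hdim (k - 2) (by lia)
  zify at hG
  refine ⟨?_, by linarith, fun m => ?_⟩
  · have h : ((k : ℤ) + 2) * (k + 3) * (2 * k - 1)
        = 6 * (Module.finrank ℝ (GspaceOplus k) - 1 : ℤ) := by linarith
    rw [h, Int.mul_ediv_cancel_left _ (by norm_num)]
    ring
  · rw [← hdim m (by lia), Int.mul_ediv_cancel_left _ (by norm_num)]
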